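/- Dichotomy for parallel punctured planes: for any ξ, η ∈ Γ³, the sets A_ξ^+ and A_η^+ are either disjoint or equal; likewise, A_ξ^− and A_η^− are either disjoint or equal. -/

import Mathlib

open Finset

noncomputable section

/-- The punctured cone `Γ³ = {η ∈ F_q⁴ \ {0} : η₁η₂ = η₃η₄}`. -/
def coneM (F : Type) [Field F] [Fintype F] [DecidableEq F] : Finset (Fin 4 → F) :=
  univ.filter fun η => η ≠ 0 ∧ η 0 * η 1 = η 2 * η 3

/-- The nonzero elements of `F`. -/
def Fx (F : Type) [Field F] [Fintype F] [DecidableEq F] : Finset F :=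
  univ.filter fun x => x ≠ 0

/-- Representatives of the projective line `P¹(F_q)`: `{(1,y) : y ∈ F_q} ∪ {(0,1)}`. -/
def P1fin (F : Type) [Field F] [Fintype F] [DecidableEq F] : Finset (F × F) :=
  (univ.image fun y => ((1 : F), y)) ∪ {((0 : F), (1 : F))}

/-- The Segre-type parametrization
`π(λ,(α₁,α₂),(β₁,β₂)) = (λα₁β₁, λα₂β₂, λα₁β₂, λα₂β₁)`. -/
def segre (F : Type) [Field F] (t : F × (F × F) × (F × F)) : Fin 4 → F :=
  ![t.1 * t.2.1.1 * t.2.2.1, t.1 * t.2.1.2 * t.2.2.2,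
    t.1 * t.2.1.1 * t.2.2.2, t.1 * t.2.1.2 * t.2.2.1]

/-- `H_ξ⁺ = {π(μ,α,y) : μ ∈ F_q^×, y ∈ P¹, y ≠ β}` for `ξ = π(λ,α,β)`. -/
def HplusFin (F : Type) [Field F] [Fintype F] [DecidableEq F] (α β : F × F) :
    Finset (Fin 4 → F) :=
  ((Fx F) ×ˢ ((P1fin F).erase β)).image fun t => segre F (t.1, α, t.2)

/-- `H_ξ⁻ = {π(μ,x,β) : μ ∈ F_q^×, x ∈ P¹, x ≠ α}` for `ξ = π(λ,α,β)`. -/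
def HminusFin (F : Type) [Field F] [Fintype F] [DecidableEq F] (α β : F × F) :
    Finset (Fin 4 → F) :=
  ((Fx F) ×ˢ ((P1fin F).erase α)).image fun t => segre F (t.1, t.2, β)

/-- The punctured line `L_ξ = {μξ : μ ∈ F_q^×}`. -/
def lineFin (F : Type) [Field F] [Fintype F] [DecidableEq F] (ξ : Fin 4 → F) :
    Finset (Fin 4 → F) :=
  (Fx F).image fun μ => μ • ξ

/-- The punctured plane `A_ξ⁺ = H_ξ⁺ ∪ L_ξ` for `ξ = π(λ,α,β)`. -/
def AplusFin (F : Type) [Field F] [Fintype F] [DecidableEq F] (lam : F) (α β : F × F) :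
    Finset (Fin 4 → F) :=
  HplusFin F α β ∪ lineFin F (segre F (lam, α, β))

/-- The punctured plane `A_ξ⁻ = H_ξ⁻ ∪ L_ξ` for `ξ = π(λ,α,β)`. -/
def AminusFin (F : Type) [Field F] [Fintype F] [DecidableEq F] (lam : F) (α β : F × F) :
    Finset (Fin 4 → F) :=
  HminusFin F α β ∪ lineFin F (segre F (lam, α, β))

theorem mem_P1 {F : Type} [Field F] [Fintype F] [DecidableEq F] {a : F × F} :
    a ∈ P1fin F ↔ (a.1 = 1 ∨ (a.1 = 0 ∧ a.2 = 1)) := by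
  obtain ⟨x, y⟩ := a
  simp only [P1fin, mem_union, mem_image, mem_univ, true_and, mem_singleton, Prod.mk.injEq]
  constructor
  · rintro (⟨_, h, _⟩ | h)
    · exact Or.inl h.symm
    · exact Or.inr h
  · rintro (h | h)
    · exact Or.inl ⟨y, h.symm, rfl⟩
    · exact Or.inr h

theorem segre_smul {F : Type} [Field F] (c m : F) (a b : F × F) :
    c • segre F (m, a, b) = segre F (c * m, a, b) := by
  funext i
  fin_cases i <;> simp [segre, mul_assoc]

theorem mem_Aplus {F : Type} [Field F] [Fintype F] [DecidableEq F] {lam : F} (hlam : lam ≠ 0)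
    {α β : F × F} (hβ : β ∈ P1fin F) (v : Fin 4 → F) :
    v ∈ AplusFin F lam α β ↔ ∃ m : F, m ≠ 0 ∧ ∃ y ∈ P1fin F, segre F (m, α, y) = v := by
  simp only [AplusFin, HplusFin, lineFin, Fx, mem_union, mem_image, mem_product, mem_filter,
    mem_univ, true_and, mem_erase, segre_smul]
  constructor
  · rintro (⟨⟨m, y⟩, ⟨hm, _, hy⟩, h⟩ | ⟨c, hc, h⟩)
    · exact ⟨m, hm, y, hy, h⟩
    · exact ⟨c * lam, mul_ne_zero hc hlam, β, hβ, h⟩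
  · rintro ⟨m, hm, y, hy, h⟩
    by_cases hyb : y = β
    · subst hyb
      exact Or.inr ⟨m / lam, div_ne_zero hm hlam, by rw [div_mul_cancel₀ _ hlam]; exact h⟩
    · exact Or.inl ⟨(m, y), ⟨hm, hyb, hy⟩, h⟩

theorem mem_Aminus {F : Type} [Field F] [Fintype F] [DecidableEq F] {lam : F} (hlam : lam ≠ 0)
    {α β : F × F} (hα : α ∈ P1fin F) (v : Fin 4 → F) :
    v ∈ AminusFin F lam α β ↔ ∃ m : F, m ≠ 0 ∧ ∃ y ∈ P1fin F, segre F (m, y, β) = v := by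
  simp only [AminusFin, HminusFin, lineFin, Fx, mem_union, mem_image, mem_product, mem_filter,
    mem_univ, true_and, mem_erase, segre_smul]
  constructor
  · rintro (⟨⟨m, y⟩, ⟨hm, _, hy⟩, h⟩ | ⟨c, hc, h⟩)
    · exact ⟨m, hm, y, hy, h⟩
    · exact ⟨c * lam, mul_ne_zero hc hlam, α, hα, h⟩
  · rintro ⟨m, hm, y, hy, h⟩
    by_cases hyb : y = α
    · subst hyb
      exact Or.inr ⟨m / lam, div_ne_zero hm hlam, by rw [div_mul_cancel₀ _ hlam]; exact h⟩
    · exact Or.inl ⟨(m, y), ⟨hm, hyb, hy⟩, h⟩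

theorem P1_eq {F : Type} [Field F] [Fintype F] [DecidableEq F] {a b : F × F}
    (ha : a ∈ P1fin F) (hb : b ∈ P1fin F) {c d : F} (hc : c ≠ 0)
    (h1 : c * a.1 = d * b.1) (h2 : c * a.2 = d * b.2) : a = b := by
  rw [mem_P1] at ha hb
  obtain ⟨a1, a2⟩ := a
  obtain ⟨b1, b2⟩ := b
  simp only [Prod.mk.injEq] at *
  grind

theorem segre_inj {F : Type} [Field F] [Fintype F] [DecidableEq F] {m k : F} {a b x y : F × F}
    (hm : m ≠ 0) (ha : a ∈ P1fin F) (hb : b ∈ P1fin F)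
    (hx : x ∈ P1fin F) (hy : y ∈ P1fin F) (h : segre F (m, a, x) = segre F (k, b, y)) :
    a = b ∧ x = y := by
  have h0 := congrFun h 0
  have h1 := congrFun h 1
  have h2 := congrFun h 2
  have h3 := congrFun h 3
  simp [segre] at h0 h1 h2 h3
  constructor
  · rcases mem_P1.1 hx with hx | ⟨_, hx⟩
    · exact P1_eq ha hb (c := m) (d := k * y.1) hm (by grind) (by grind)
    · exact P1_eq ha hb (c := m) (d := k * y.2) hm (by grind) (by grind)
  · rcases mem_P1.1 ha with ha | ⟨_, ha⟩
    · exact P1_eq hx hy (c := m) (d := k * b.1) hm (by grind) (by grind)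
    · exact P1_eq hx hy (c := m) (d := k * b.2) hm (by grind) (by grind)

/-- Dichotomy for parallel punctured planes: two planes `A_ξ⁺`, `A_η⁺` are either
disjoint or equal, and likewise for `A_ξ⁻`, `A_η⁻`. -/
theorem Apm_dichotomy (p n : ℕ) (hp : p.Prime) (hodd : Odd p) (hn : 0 < n)
    (F : Type) [Field F] [Fintype F] [DecidableEq F] (hcard : Fintype.card F = p ^ n)
    (lam mu : F) (hlam : lam ≠ 0) (hmu : mu ≠ 0) (α β γ δ : F × F)
    (hα : α ∈ P1fin F) (hβ : β ∈ P1fin F) (hγ : γ ∈ P1fin F) (hδ : δ ∈ P1fin F) :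
    (AplusFin F lam α β ∩ AplusFin F mu γ δ = ∅ ∨
      AplusFin F lam α β = AplusFin F mu γ δ) ∧
    (AminusFin F lam α β ∩ AminusFin F mu γ δ = ∅ ∨
      AminusFin F lam α β = AminusFin F mu γ δ) := by
  constructor
  · rw [or_iff_not_imp_left, ← Ne, ← Finset.nonempty_iff_ne_empty]
    rintro ⟨v, hv⟩
    rw [mem_inter, mem_Aplus hlam hβ, mem_Aplus hmu hδ] at hv
    obtain ⟨⟨m, hm, x, hx, h⟩, ⟨k, hk, y, hy, h'⟩⟩ := hv
    obtain ⟨rfl, _⟩ := segre_inj hm hα hγ hx hy (h.trans h'.symm)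
    ext w
    rw [mem_Aplus hlam hβ, mem_Aplus hmu hδ]
  · rw [or_iff_not_imp_left, ← Ne, ← Finset.nonempty_iff_ne_empty]
    rintro ⟨v, hv⟩
    rw [mem_inter, mem_Aminus hlam hα, mem_Aminus hmu hγ] at hv
    obtain ⟨⟨m, hm, x, hx, h⟩, ⟨k, hk, y, hy, h'⟩⟩ := hv
    obtain ⟨_, rfl⟩ := segre_inj hm hx hy hβ hδ (h.trans h'.symm)
    ext w
    rw [mem_Aminus hlam hα, mem_Aminus hmu hγ]
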